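/- arXiv:1508.07758 — 6 statements merged into one kernel-verified Lean document; each statement's English description precedes it below -/
import Mathlib

section
/- For every γ ∈ ℂ with sin γ ≠ 0, every grading (ε₁,ε₂,ε₃) ∈ {+1,−1}³, and all v, w, ν ∈ ℂ, the q=3 Perk-Schultz R-matrix satisfies the Yang-Baxter equation in the form Σ_{a',b',c'=1}^{3} R^{a b}_{a' b'}(v,w) · R^{a' c}_{a'' c'}(v,ν) · R^{b' c'}_{b'' c''}(w,ν) = Σ_{a',b',c'=1}^{3} R^{b c}_{b' c'}(w,ν) · R^{a c'}_{a' c''}(v,ν) · R^{a' b'}_{a'' b''}(v,w), for all indices a, b, c, a'', b'', c'' ∈ {1,2,3}. -/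
noncomputable section

/-- `α_a(v,w) = sin(γ + ε_a(v−w))/sin γ`. -/
def alphaF (γ : ℂ) (ε : Fin 3 → ℤ) (a : Fin 3) (v w : ℂ) : ℂ :=
  Complex.sin (γ + (ε a : ℂ) * (v - w)) / Complex.sin γ

/-- `β(v,w) = sin(v−w)/sin γ`. -/
def betaF (γ v w : ℂ) : ℂ := Complex.sin (v - w) / Complex.sin γ

/-- The `q = 3` Perk-Schultz R-matrix: `Rmat γ ε v w a b c d = R^{ab}_{cd}(v,w)`, whose
only nonzero entries are `R^{aa}_{aa} = α_a`, `R^{ab}_{ab} = β` for `a ≠ b`, and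
`R^{ab}_{ba} = e^{i·sgn(a−b)(v−w)}` for `a ≠ b`. -/
def Rmat (γ : ℂ) (ε : Fin 3 → ℤ) (v w : ℂ) (a b c d : Fin 3) : ℂ :=
  if a = c ∧ b = d ∧ a = b then alphaF γ ε a v w
  else if a = c ∧ b = d then betaF γ v w
  else if a = d ∧ b = c then
    Complex.exp (Complex.I * ((Int.sign ((a.val : ℤ) - (b.val : ℤ)) : ℤ) : ℂ) * (v - w))
  else 0

/-- The entries of `Rmat` as polynomials in `ε`, the imaginary unit `i`, `κ = cot γ`,
`t = 1 / sin γ`, `p = cos (v - w)` and `q = sin (v - w)`. -/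
def rPoly {A : Type*} [CommRing A] (i κ t : A) (ε : Fin 3 → A) (p q : A) (a b c d : Fin 3) : A :=
  if a = c ∧ b = d ∧ a = b then p + ε a * κ * q
  else if a = c ∧ b = d then q * t
  else if a = d ∧ b = c then
    p + ((Int.sign ((a.val : ℤ) - (b.val : ℤ)) : ℤ) : A) * (q * i)
  else 0

theorem exp_I_mul_sign_mul (n : ℤ) (hn : n ≠ 0) (z : ℂ) :
    Complex.exp (Complex.I * (n.sign : ℂ) * z) =
      Complex.cos z + (n.sign : ℂ) * (Complex.sin z * Complex.I) := by
  rcases lt_or_gt_of_ne hn with h | h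
  · rw [Int.sign_eq_neg_one_of_neg h, show Complex.I * ((-1 : ℤ) : ℂ) * z = -z * Complex.I by
      push_cast; ring, Complex.exp_mul_I, Complex.cos_neg, Complex.sin_neg]
    push_cast
    ring
  · rw [Int.sign_eq_one_of_pos h, show Complex.I * ((1 : ℤ) : ℂ) * z = z * Complex.I by
      push_cast; ring, Complex.exp_mul_I]
    push_cast
    ring

theorem Rmat_eq_rPoly (γ : ℂ) (hγ : Complex.sin γ ≠ 0) (ε : Fin 3 → ℤ)
    (hε : ∀ a, ε a = 1 ∨ ε a = -1) (v w : ℂ) (a b c d : Fin 3) :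
    Rmat γ ε v w a b c d =
      rPoly Complex.I (Complex.cos γ / Complex.sin γ) (Complex.sin γ)⁻¹ (fun i => (ε i : ℂ))
        (Complex.cos (v - w)) (Complex.sin (v - w)) a b c d := by
  unfold Rmat rPoly
  split_ifs with h₁ h₂ h₃
  · rw [alphaF, Complex.sin_add]
    rcases hε a with h | h <;> simp only [h] <;> push_cast <;>
      simp only [one_mul, neg_one_mul, Complex.cos_neg, Complex.sin_neg] <;> field_simp
  · rfl
  · refine exp_I_mul_sign_mul _ (fun h => h₁ ?_) _
    have hab : a = b := Fin.ext (by omega)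
    obtain ⟨rfl, rfl⟩ := h₃
    exact ⟨hab, hab.symm, hab⟩
  · rfl

theorem sum_rPoly_mul {A : Type*} [CommRing A] (i κ t : A) (ε : Fin 3 → A) (p q : A)
    (a b : Fin 3) (f : Fin 3 → Fin 3 → A) :
    ∑ x, ∑ y, rPoly i κ t ε p q a b x y * f x y =
      if a = b then rPoly i κ t ε p q a a a a * f a a
      else rPoly i κ t ε p q a b a b * f a b + rPoly i κ t ε p q a b b a * f b a := by
  fin_cases a <;> fin_cases b <;> simp [Fin.sum_univ_three, rPoly, add_comm]

set_option maxHeartbeats 4000000 in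
theorem rPoly_yangBaxter {A : Type*} [CommRing A] (i κ t : A) (hi : i ^ 2 = -1)
    (hκ : κ ^ 2 = t ^ 2 - 1) (ε : Fin 3 → A) (hε : ∀ a, ε a ^ 2 = 1) (p q r s : A)
    (hpq : q ^ 2 = 1 - p ^ 2) (hrs : s ^ 2 = 1 - r ^ 2)
    (a b c a'' b'' c'' : Fin 3) :
    (∑ a' : Fin 3, ∑ b' : Fin 3, ∑ c' : Fin 3,
        rPoly i κ t ε p q a b a' b' * rPoly i κ t ε (p * r - q * s) (q * r + p * s) a' c a'' c' *
          rPoly i κ t ε r s b' c' b'' c'') =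
      ∑ a' : Fin 3, ∑ b' : Fin 3, ∑ c' : Fin 3,
        rPoly i κ t ε r s b c b' c' * rPoly i κ t ε (p * r - q * s) (q * r + p * s) a c' a' c'' *
          rPoly i κ t ε p q a' b' a'' b'' := by
  have hcomm (F : Fin 3 → Fin 3 → Fin 3 → A) :
      ∑ x, ∑ y, ∑ z, F x y z = ∑ y, ∑ z, ∑ x, F x y z := by
    rw [Finset.sum_comm]
    exact Finset.sum_congr rfl fun _ _ => Finset.sum_comm
  rw [hcomm fun a' b' c' => rPoly i κ t ε r s b c b' c' * _ * _]
  simp only [mul_assoc, ← Finset.mul_sum, sum_rPoly_mul]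
  have h0 := hε 0
  have h1 := hε 1
  have h2 := hε 2
  clear hε
  fin_cases a <;> fin_cases b <;> fin_cases c <;>
    simp [Fin.sum_univ_three, rPoly] <;>
    fin_cases a'' <;> fin_cases b'' <;> fin_cases c'' <;> simp <;> grind

/-- The Yang-Baxter equation for the `q = 3` Perk-Schultz R-matrix, for every anisotropy
`γ` with `sin γ ≠ 0`, every grading `(ε₁,ε₂,ε₃) ∈ {±1}³`, all spectral parameters and all
external indices. -/
theorem stmt1 (γ : ℂ) (hγ : Complex.sin γ ≠ 0) (ε : Fin 3 → ℤ)
    (hε : ∀ a, ε a = 1 ∨ ε a = -1) (v w ν : ℂ) (a b c a'' b'' c'' : Fin 3) :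
    (∑ a' : Fin 3, ∑ b' : Fin 3, ∑ c' : Fin 3,
        Rmat γ ε v w a b a' b' * Rmat γ ε v ν a' c a'' c' * Rmat γ ε w ν b' c' b'' c'') =
      ∑ a' : Fin 3, ∑ b' : Fin 3, ∑ c' : Fin 3,
        Rmat γ ε w ν b c b' c' * Rmat γ ε v ν a c' a' c'' * Rmat γ ε v w a' b' a'' b'' := by
  simp only [Rmat_eq_rPoly γ hγ ε hε]
  rw [show v - ν = (v - w) + (w - ν) by ring, Complex.cos_add, Complex.sin_add]
  refine rPoly_yangBaxter _ _ _ Complex.I_sq ?_ _ (fun a => ?_) _ _ _ _ (Complex.sin_sq _) (Complex.sin_sq _) ..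
  · rw [div_pow, Complex.cos_sq']
    field_simp
  · rcases hε a with h | h <;> simp [h]

end
end

section
/- Let V be a complex vector space, let v₁, …, v_n ∈ ℂ be parameters with α₁(vᵢ,vⱼ) ≠ 0 for all i ≠ j, and let B₁(vⱼ), B₂(vⱼ) be endomorphisms of V satisfying the exchange relations B_{a₁}(vᵢ) B_{a₂}(vⱼ) = Σ_{b₁,b₂=1}^{2} Ř^{(1)}{}^{b₁ b₂}_{a₁ a₂}(vᵢ,vⱼ) B_{b₁}(vⱼ) B_{b₂}(vᵢ) for all i ≠ j and all indices a₁,a₂. Define the inhomogeneous transfer matrix entries t^{(n)}{}^{a_n⋯a₁}_{b_n⋯b₁}(v,{vⱼ}) = Σ_{a,c_n,…,c₂=1}^{2} R^{(1)}{}^{a a_n}_{c_n b_n}(v,v_n) R^{(1)}{}^{c_n a_{n−1}}_{c_{n−1} b_{n−1}}(v,v_{n−1}) ⋯ R^{(1)}{}^{c₃ a₂}_{c₂ b₂}(v,v₂) R^{(1)}{}^{c₂ a₁}_{a b₁}(v,v₁), where R^{(1)}(v,w) = P Ř^{(1)}(v,w) and P is the permutation operator on ℂ²⊗ℂ². Then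 for all indices b₁, …, b_n ∈ {1,2}: B_{b₁}(v₁) B_{b₂}(v₂) ⋯ B_{b_n}(v_n) = Σ_{a₁,…,a_n} t^{(n)}{}^{a_n⋯a₁}_{b_n⋯b₁}(v₁,{vⱼ}) · B_{a₂}(v₂) B_{a₃}(v₃) ⋯ B_{a_n}(v_n) B_{a₁}(v₁). -/
noncomputable section

/-- `γ₊(v,w) = e^{i(v−w)}`. -/
def gammaP (v w : ℂ) : ℂ := Complex.exp (Complex.I * (v - w))

/-- `γ₋(v,w) = e^{−i(v−w)}`. -/
def gammaM (v w : ℂ) : ℂ := Complex.exp (-(Complex.I * (v - w)))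

/-- The second-level braided R-matrix `Ř⁽¹⁾(v,w)`: `Rc1 γ ε v w b₁ b₂ a₁ a₂` is the
entry `Ř⁽¹⁾{}^{b₁b₂}_{a₁a₂}(v,w)`, i.e. the matrix
`(1/α₁)·[[α₂,0,0,0],[0,γ₊,β,0],[0,β,γ₋,0],[0,0,0,α₃]]` in the ordered basis
`(e₁⊗e₁, e₁⊗e₂, e₂⊗e₁, e₂⊗e₂)` of `ℂ²⊗ℂ²`, rows labelled by `(b₁,b₂)` and columns by
`(a₁,a₂)`. -/
def Rc1 (γ : ℂ) (ε : Fin 3 → ℤ) (v w : ℂ) (b1 b2 a1 a2 : Fin 2) : ℂ :=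
  (if b1 = a1 ∧ b2 = a2 then
      if a1 = 0 ∧ a2 = 0 then alphaF γ ε 1 v w
      else if a1 = 1 ∧ a2 = 1 then alphaF γ ε 2 v w
      else if a1 = 0 ∧ a2 = 1 then gammaP v w
      else gammaM v w
    else if b1 = a2 ∧ b2 = a1 then betaF γ v w
    else 0) / alphaF γ ε 0 v w

/-- The entries `t^{(n)}{}^{a_n⋯a₁}_{b_n⋯b₁}(v,{vⱼ})` of the inhomogeneous transfer
matrix built from `R⁽¹⁾(v,w) = P Ř⁽¹⁾(v,w)`: the trace over the auxiliary space of the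
ordered product of the local matrices `(M_j)_{r c} = R⁽¹⁾{}^{r a_j}_{c b_j}(v,v_j)`,
`j = n, …, 1`. -/
def tmat (γ : ℂ) (ε : Fin 3 → ℤ) (n : ℕ) (v : ℂ) (vs : Fin n → ℂ)
    (as bs : Fin n → Fin 2) : ℂ :=
  Matrix.trace
    ((List.ofFn fun j : Fin n =>
        Matrix.of fun r c : Fin 2 => Rc1 γ ε v (vs j) (as j) r c (bs j)).reverse.prod)

/-- Moving `x c` through an ordered product of the `y j`, picking up the monodromy matrix of the
exchange coefficients `R j`. -/
theorem mul_prod_ofFn_of_exchange {K A ι : Type*} [CommRing K] [Ring A] [Algebra K A]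
    [Fintype ι] [DecidableEq ι] (x : ι → A) :
    ∀ (m : ℕ) (y : Fin m → ι → A) (R : Fin m → ι → ι → ι → ι → K)
      (_ : ∀ j a1 a2, x a1 * y j a2 = ∑ b1, ∑ b2, R j b1 b2 a1 a2 • (y j b1 * x b2))
      (bs : Fin m → ι) (c : ι),
      x c * (List.ofFn fun j => y j (bs j)).prod =
        ∑ as : Fin m → ι, ∑ r,
          (List.ofFn fun j => Matrix.of fun r c => R j (as j) r c (bs j)).reverse.prod r c •
            ((List.ofFn fun j => y j (as j)).prod * x r) := by
  intro m
  induction m with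
  | zero =>
    intro y R _ bs c
    simp [Matrix.one_apply, ite_smul]
  | succ m ih =>
    intro y R h bs c
    rw [← (Fin.consEquiv fun _ : Fin (m + 1) => ι).sum_comp, Fintype.sum_prod_type]
    simp only [Fin.consEquiv_apply, List.ofFn_succ, List.prod_cons, List.reverse_cons,
      List.prod_append, List.prod_nil, mul_one, Fin.cons_zero, Fin.cons_succ, Matrix.mul_apply,
      Matrix.of_apply]
    rw [← mul_assoc, h, Finset.sum_mul]
    refine Finset.sum_congr rfl fun a _ => ?_
    simp only [Finset.sum_mul, smul_mul_assoc, mul_assoc,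
      ih (fun j => y j.succ) (fun j => R j.succ) (fun j => h j.succ) (fun j => bs j.succ),
      Finset.mul_sum, Finset.smul_sum, Finset.sum_smul, mul_smul_comm, smul_smul]
    rw [Finset.sum_comm]
    refine Finset.sum_congr rfl fun as _ => ?_
    rw [Finset.sum_comm]
    refine Finset.sum_congr rfl fun r _ => Finset.sum_congr rfl fun k _ => ?_
    rw [mul_comm]

/-- Cyclically rotating an ordered product moves its first factor to the end. -/
theorem prod_ofFn_finRotate {M : Type*} [Monoid M] (n : ℕ) (f : Fin (n + 1) → M) :
    (List.ofFn fun j => f (finRotate (n + 1) j)).prod =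
      (List.ofFn fun j : Fin n => f j.succ).prod * f 0 := by
  rw [List.ofFn_succ']
  simp [List.concat_eq_append]

/-- `Ř⁽¹⁾(v,v)` is the identity. -/
theorem Rc1_self (γ : ℂ) (hγ : Complex.sin γ ≠ 0) (ε : Fin 3 → ℤ) (v : ℂ)
    (b1 b2 a1 a2 : Fin 2) :
    Rc1 γ ε v v b1 b2 a1 a2 = if b1 = a1 ∧ b2 = a2 then 1 else 0 := by
  simp [Rc1, alphaF, betaF, gammaP, gammaM, hγ]

/-- At `v = v₁` the auxiliary trace collapses to a single entry of the monodromy matrix. -/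
theorem tmat_zero_eq (γ : ℂ) (hγ : Complex.sin γ ≠ 0) (ε : Fin 3 → ℤ) (n : ℕ)
    (vs : Fin (n + 1) → ℂ) (as bs : Fin (n + 1) → Fin 2) :
    tmat γ ε (n + 1) (vs 0) vs as bs =
      (List.ofFn fun j : Fin n => Matrix.of fun r c : Fin 2 =>
        Rc1 γ ε (vs 0) (vs j.succ) (as j.succ) r c (bs j.succ)).reverse.prod (as 0) (bs 0) := by
  simp only [tmat, List.ofFn_succ, List.reverse_cons, List.prod_append, List.prod_cons,
    List.prod_nil, mul_one, Matrix.trace, Matrix.diag_apply, Matrix.mul_apply, Matrix.of_apply,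
    Rc1_self γ hγ]
  simp [ite_and]

/-- Cyclic-symmetry lemma of the first-level Bethe ansatz: if the operators `B_a(vⱼ)`
satisfy the exchange relations governed by `Ř⁽¹⁾`, then the ordered product
`B_{b₁}(v₁)⋯B_{b_n}(v_n)` equals the sum over `a` of
`t^{(n)}{}^{a_n⋯a₁}_{b_n⋯b₁}(v₁,{vⱼ}) · B_{a₂}(v₂)⋯B_{a_n}(v_n)B_{a₁}(v₁)`. -/
theorem stmt2 (γ : ℂ) (hγ : Complex.sin γ ≠ 0) (ε : Fin 3 → ℤ)
    (hε : ∀ a, ε a = 1 ∨ ε a = -1)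
    (V : Type*) [AddCommGroup V] [Module ℂ V]
    (n : ℕ) (vs : Fin (n + 1) → ℂ)
    (hα : ∀ i j : Fin (n + 1), i ≠ j → alphaF γ ε 0 (vs i) (vs j) ≠ 0)
    (B : Fin 2 → ℂ → Module.End ℂ V)
    (hexch : ∀ i j : Fin (n + 1), i ≠ j → ∀ a1 a2 : Fin 2,
      B a1 (vs i) * B a2 (vs j) =
        ∑ b1 : Fin 2, ∑ b2 : Fin 2,
          Rc1 γ ε (vs i) (vs j) b1 b2 a1 a2 • (B b1 (vs j) * B b2 (vs i)))
    (bs : Fin (n + 1) → Fin 2) :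
    (List.ofFn fun j : Fin (n + 1) => B (bs j) (vs j)).prod =
      ∑ as : Fin (n + 1) → Fin 2,
        tmat γ ε (n + 1) (vs 0) vs as bs •
          (List.ofFn fun j : Fin (n + 1) =>
            B (as (finRotate (n + 1) j)) (vs (finRotate (n + 1) j))).prod := by
  have key := mul_prod_ofFn_of_exchange (K := ℂ) (fun a => B a (vs 0)) n
    (fun j a => B a (vs j.succ)) (fun j => Rc1 γ ε (vs 0) (vs j.succ))
    (fun j => hexch 0 j.succ (Fin.succ_ne_zero j).symm) (fun j => bs j.succ) (bs 0)
  rw [List.ofFn_succ, List.prod_cons, key,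
    ← (Fin.consEquiv fun _ : Fin (n + 1) => Fin 2).sum_comp, Fintype.sum_prod_type,
    Finset.sum_comm]
  refine Finset.sum_congr rfl fun r _ => Finset.sum_congr rfl fun as _ => ?_
  rw [tmat_zero_eq γ hγ, prod_ofFn_finRotate n fun j =>
    B (Fin.consEquiv (fun _ : Fin (n + 1) => Fin 2) (r, as) j) (vs j)]
  simp only [Fin.consEquiv_apply, Fin.cons_zero, Fin.cons_succ]

end
end

section
/- Second-level algebraic Bethe ansatz: Let H be a complex vector space and, for each v ∈ ℂ, let A(v), B(v), D(v) be endomorphisms of H satisfying, for all v, w with β(v,w) ≠ 0: A(v)A(w) = A(w)A(v); B(v)B(w) = B(w)B(v); A(v)B(w) = g₂(w,v) B(w)A(v) − h₋(w,v) B(v)A(w); D(v)B(w) = g₃(v,w) B(w)D(v) − h₊(v,w) B(v)D(w). Suppose Ω ∈ H and a, d : ℂ → ℂ satisfy A(v)Ω = a(v)Ω and D(v)Ω = d(v)Ω for all v. Fix pairwise distinct v₁, …, v_m ∈ ℂ (with β(vᵢ,vⱼ) ≠ 0 for i ≠ j) satisfying the Bethe equations a(v_k) ∏_{j≠k} g₂(v_j,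 v_k) = d(v_k) ∏_{j≠k} g₃(v_k, v_j) for each k = 1,…,m. Then Φ = B(v₁)⋯B(v_m) Ω satisfies, for every v ∈ ℂ with β(v_j, v) ≠ 0 for all j: (A(v) + D(v)) Φ = Λ(v) Φ, where Λ(v) = a(v) ∏_{j=1}^{m} g₂(v_j, v) + d(v) ∏_{j=1}^{m} g₃(v, v_j). -/
noncomputable section

/-- `g_a(v,w) = α_a(v,w)/β(v,w)`. -/
def gF (γ : ℂ) (ε : Fin 3 → ℤ) (a : Fin 3) (v w : ℂ) : ℂ :=
  alphaF γ ε a v w / betaF γ v w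

/-- `h₊(v,w) = γ₊(v,w)/β(v,w) = e^{i(v−w)}/β(v,w)`. -/
def hP (γ v w : ℂ) : ℂ := Complex.exp (Complex.I * (v - w)) / betaF γ v w

/-- `h₋(v,w) = γ₋(v,w)/β(v,w) = e^{−i(v−w)}/β(v,w)`. -/
def hM (γ v w : ℂ) : ℂ := Complex.exp (-(Complex.I * (v - w))) / betaF γ v w

/-- Action of an operator family `T`, exchanged past the creation operators `B` by a two-term
relation, on a Bethe vector: one wanted term, and one unwanted term for each parameter. The vector
`P s` stands for the product of the `B (x j)`, `j ∈ s`, applied to the pseudovacuum `P ∅`. -/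
theorem exchange_apply_bethe_vector {K X ι V : Type*} [CommRing K] [DecidableEq ι]
    [AddCommGroup V] [Module K V] (T B : X → Module.End K V) (G H : X → X → K) (t : X → K)
    (R : X → X → Prop) (hBB : ∀ v w, R v w → B v * B w = B w * B v)
    (hTB : ∀ v w, R v w → T v * B w = G v w • (B w * T v) - H v w • (B v * T w))
    (hGH : ∀ v u w, R v u → R v w → R u w →
      G v u * H v w - H v u * H u w = H v w * G w u)
    (x : ι → X) (hx : ∀ i j, i ≠ j → R (x i) (x j))
    (P : Finset ι → V) (hP : ∀ i s, i ∉ s → P (insert i s) = B (x i) (P s))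
    (hT : ∀ v, T v (P ∅) = t v • P ∅) (s : Finset ι) :
    ∀ v, (∀ j ∈ s, R v (x j)) →
      T v (P s) = (t v * ∏ j ∈ s, G v (x j)) • P s -
        ∑ k ∈ s, (H v (x k) * (t (x k) * ∏ j ∈ s.erase k, G (x k) (x j))) •
          B v (P (s.erase k)) := by
  induction s using Finset.induction_on with
  | empty => simp [hT]
  | insert i s hi ih =>
    intro v hv
    have hvi : R v (x i) := hv i (Finset.mem_insert_self i s)
    have hvs : ∀ j ∈ s, R v (x j) := fun j hj => hv j (Finset.mem_insert_of_mem hj)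
    have his : ∀ j ∈ s, R (x i) (x j) := fun j hj => hx i j (by rintro rfl; exact hi hj)
    have hcomm : ∀ y, B (x i) (B v y) = B v (B (x i) y) := fun y =>
      (LinearMap.congr_fun (hBB v (x i) hvi) y).symm
    have hexch := LinearMap.congr_fun (hTB v (x i) hvi) (P s)
    simp only [Module.End.mul_apply, LinearMap.sub_apply, LinearMap.smul_apply] at hexch
    have hsum : ∑ k ∈ s, (H v (x k) * (t (x k) * ∏ j ∈ (insert i s).erase k, G (x k) (x j))) •
          B v (P ((insert i s).erase k)) =
        G v (x i) • ∑ k ∈ s, (H v (x k) * (t (x k) * ∏ j ∈ s.erase k, G (x k) (x j))) •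
          B v (B (x i) (P (s.erase k))) -
        H v (x i) • ∑ k ∈ s, (H (x i) (x k) * (t (x k) * ∏ j ∈ s.erase k, G (x k) (x j))) •
          B v (B (x i) (P (s.erase k))) := by
      rw [Finset.smul_sum, Finset.smul_sum, ← Finset.sum_sub_distrib]
      refine Finset.sum_congr rfl fun k hk => ?_
      have hik : i ≠ k := by rintro rfl; exact hi hk
      have his' : i ∉ s.erase k := fun h => hi (Finset.mem_of_mem_erase h)
      rw [Finset.erase_insert_of_ne hik, Finset.prod_insert his', hP i _ his', smul_smul,
        smul_smul, ← sub_smul]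
      congr 1
      linear_combination (-(t (x k) * ∏ j ∈ s.erase k, G (x k) (x j))) *
        hGH v (x i) (x k) hvi (hvs k hk) (his k hk)
    rw [Finset.sum_insert hi, hsum, Finset.erase_insert hi, Finset.prod_insert hi, hP i s hi,
      hexch, ih v hvs, ih (x i) his]
    simp only [map_sub, map_sum, map_smul, hcomm]
    module

theorem betaF_ne_zero_iff {γ : ℂ} (hγ : Complex.sin γ ≠ 0) (v w : ℂ) :
    betaF γ v w ≠ 0 ↔ Complex.sin (v - w) ≠ 0 := by
  simp [betaF, hγ]

theorem betaF_ne_zero_comm {γ v w : ℂ} (h : betaF γ v w ≠ 0) : betaF γ w v ≠ 0 := by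
  rw [betaF, ← neg_sub v w, Complex.sin_neg, neg_div]
  exact neg_ne_zero.mpr h

theorem hM_swap (γ v w : ℂ) : hM γ w v = -hP γ v w := by
  rw [hM, hP, betaF, betaF, ← neg_sub v w, Complex.sin_neg, neg_div, div_neg, mul_neg, neg_neg]

theorem gF_eq {γ : ℂ} (hγ : Complex.sin γ ≠ 0) {ε : Fin 3 → ℤ} {a : Fin 3}
    (hε : ε a = 1 ∨ ε a = -1) {v w : ℂ} (h : Complex.sin (v - w) ≠ 0) :
    gF γ ε a v w =
      Complex.sin γ * Complex.cos (v - w) / Complex.sin (v - w) + ε a * Complex.cos γ := by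
  rcases hε with hε | hε
  · simp only [gF, alphaF, betaF, hε, Int.cast_one, one_mul, Complex.sin_add]
    field_simp
  · simp only [gF, alphaF, betaF, hε, Int.cast_neg, Int.cast_one, neg_mul, one_mul,
      Complex.sin_add, Complex.sin_neg, Complex.cos_neg]
    field_simp

/-- The difference of two values of `g_a` given by the subtraction formula for the cotangent. -/
theorem gF_sub_gF {γ : ℂ} (hγ : Complex.sin γ ≠ 0) {ε : Fin 3 → ℤ} {a : Fin 3}
    (hε : ε a = 1 ∨ ε a = -1) {v w v' w' : ℂ} (h : Complex.sin (v - w) ≠ 0)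
    (h' : Complex.sin (v' - w') ≠ 0) :
    gF γ ε a v w - gF γ ε a v' w' =
      Complex.sin γ * Complex.sin (v' - w' - (v - w)) /
        (Complex.sin (v - w) * Complex.sin (v' - w')) := by
  rw [gF_eq hγ hε h, gF_eq hγ hε h', Complex.sin_sub (v' - w')]
  field_simp
  ring

theorem gF_mul_hP_sub {γ : ℂ} (hγ : Complex.sin γ ≠ 0) {ε : Fin 3 → ℤ} {a : Fin 3}
    (hε : ε a = 1 ∨ ε a = -1) {v u w : ℂ} (hvu : betaF γ v u ≠ 0) (hvw : betaF γ v w ≠ 0)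
    (huw : betaF γ u w ≠ 0) :
    gF γ ε a v u * hP γ v w - hP γ v u * hP γ u w = hP γ v w * gF γ ε a w u := by
  have hwu := betaF_ne_zero_comm huw
  rw [betaF_ne_zero_iff hγ] at hvu hvw huw hwu
  have key := gF_sub_gF hγ hε hvu hwu
  have hs : Complex.sin (w - u - (v - u)) = -Complex.sin (v - w) := by
    rw [← Complex.sin_neg]; ring_nf
  have hs' : Complex.sin (w - u) = -Complex.sin (u - w) := by
    rw [← Complex.sin_neg]; ring_nf
  have he : Complex.exp (Complex.I * (v - w)) =
      Complex.exp (Complex.I * (v - u)) * Complex.exp (Complex.I * (u - w)) := by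
    rw [← Complex.exp_add]; ring_nf
  have hh : hP γ v u * hP γ u w = (gF γ ε a v u - gF γ ε a w u) * hP γ v w := by
    rw [key, hs, hs']
    simp only [hP, betaF, he]
    field_simp
  rw [hh]
  ring

theorem gF_mul_hM_sub {γ : ℂ} (hγ : Complex.sin γ ≠ 0) {ε : Fin 3 → ℤ} {a : Fin 3}
    (hε : ε a = 1 ∨ ε a = -1) {v u w : ℂ} (hvu : betaF γ v u ≠ 0) (hvw : betaF γ v w ≠ 0)
    (huw : betaF γ u w ≠ 0) :
    gF γ ε a u v * hM γ w v - hM γ u v * hM γ w u = hM γ w v * gF γ ε a u w := by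
  have huv := betaF_ne_zero_comm hvu
  rw [betaF_ne_zero_iff hγ] at hvu hvw huw huv
  have key := gF_sub_gF hγ hε huv huw
  have hs : Complex.sin (u - w - (u - v)) = Complex.sin (v - w) := by ring_nf
  have hs' : Complex.sin (u - v) = -Complex.sin (v - u) := by
    rw [← Complex.sin_neg]; ring_nf
  have he : Complex.exp (Complex.I * (v - w)) =
      Complex.exp (Complex.I * (v - u)) * Complex.exp (Complex.I * (u - w)) := by
    rw [← Complex.exp_add]; ring_nf
  have hh : hM γ u v * hM γ w u = (gF γ ε a u v - gF γ ε a u w) * hM γ w v := by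
    rw [key, hs, hs']
    simp only [hM_swap, hP, betaF, he]
    field_simp
  rw [hh]
  ring

/-- Second-level algebraic Bethe ansatz (XXZ-type): if `A, B, D` satisfy the stated
commutation relations, `Ω` is a pseudovacuum with eigenvalue functions `a, d`, and the
pairwise distinct parameters `v₁, …, v_m` satisfy the Bethe equations
`a(v_k) ∏_{j≠k} g₂(v_j,v_k) = d(v_k) ∏_{j≠k} g₃(v_k,v_j)`, then
`Φ = B(v₁)⋯B(v_m)Ω` is an eigenvector of `A(v) + D(v)` with eigenvalue
`Λ(v) = a(v) ∏_j g₂(v_j,v) + d(v) ∏_j g₃(v,v_j)`. -/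
theorem stmt5 (γ : ℂ) (hγ : Complex.sin γ ≠ 0) (ε : Fin 3 → ℤ)
    (hε : ∀ a, ε a = 1 ∨ ε a = -1)
    (V : Type*) [AddCommGroup V] [Module ℂ V]
    (A B D : ℂ → Module.End ℂ V)
    (hAA : ∀ v w : ℂ, betaF γ v w ≠ 0 → A v * A w = A w * A v)
    (hBB : ∀ v w : ℂ, betaF γ v w ≠ 0 → B v * B w = B w * B v)
    (hAB : ∀ v w : ℂ, betaF γ v w ≠ 0 →
      A v * B w = gF γ ε 1 w v • (B w * A v) - hM γ w v • (B v * A w))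
    (hDB : ∀ v w : ℂ, betaF γ v w ≠ 0 →
      D v * B w = gF γ ε 2 v w • (B w * D v) - hP γ v w • (B v * D w))
    (Ω : V) (a d : ℂ → ℂ)
    (hΩA : ∀ v : ℂ, A v Ω = a v • Ω) (hΩD : ∀ v : ℂ, D v Ω = d v • Ω)
    (m : ℕ) (vs : Fin m → ℂ) (hinj : Function.Injective vs)
    (hβ : ∀ i j : Fin m, i ≠ j → betaF γ (vs i) (vs j) ≠ 0)
    (hBAE : ∀ k : Fin m,
      a (vs k) * ∏ j ∈ Finset.univ.erase k, gF γ ε 1 (vs j) (vs k) =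
        d (vs k) * ∏ j ∈ Finset.univ.erase k, gF γ ε 2 (vs k) (vs j))
    (Φ : V) (hΦ : Φ = (List.ofFn fun j : Fin m => B (vs j)).prod Ω)
    (v : ℂ) (hv : ∀ j : Fin m, betaF γ (vs j) v ≠ 0) :
    (A v + D v) Φ =
      (a v * ∏ j : Fin m, gF γ ε 1 (vs j) v +
        d v * ∏ j : Fin m, gF γ ε 2 v (vs j)) • Φ := by
  have hcomm : ∀ s : Finset (Fin m),
      (s : Set (Fin m)).Pairwise (Function.onFun Commute fun j => B (vs j)) :=
    fun s i _ j _ hij => hBB _ _ (hβ i j hij)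
  let P : Finset (Fin m) → V := fun s => s.noncommProd (fun j => B (vs j)) (hcomm s) Ω
  have hP_insert : ∀ i s, i ∉ s → P (insert i s) = B (vs i) (P s) := fun i s hi => by
    simp only [P]
    rw [Finset.noncommProd_insert_of_notMem _ _ _ _ hi, Module.End.mul_apply]
  have hP₀ : P ∅ = Ω := by simp [P]
  have hΦP : Φ = P Finset.univ := by
    have huniv : (List.finRange m).toFinset = Finset.univ := by ext; simp
    have := Finset.noncommProd_toFinset (List.finRange m) (fun j => B (vs j)) (hcomm _)
      (List.nodup_finRange m)
    simp only [huniv] at this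
    simp only [hΦ, P, this, List.ofFn_eq_map]
  have hv' : ∀ j ∈ Finset.univ, betaF γ v (vs j) ≠ 0 := fun j _ => betaF_ne_zero_comm (hv j)
  have hA := exchange_apply_bethe_vector A B (fun v w => gF γ ε 1 w v) (fun v w => hM γ w v) a
    (fun v w => betaF γ v w ≠ 0) hBB hAB
    (fun _ _ _ h₁ h₂ h₃ => gF_mul_hM_sub hγ (hε 1) h₁ h₂ h₃) vs hβ P hP_insert
    (by simpa only [hP₀] using hΩA) Finset.univ v hv'
  have hD := exchange_apply_bethe_vector D B (gF γ ε 2) (hP γ) d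
    (fun v w => betaF γ v w ≠ 0) hBB hDB
    (fun _ _ _ h₁ h₂ h₃ => gF_mul_hP_sub hγ (hε 2) h₁ h₂ h₃) vs hβ P hP_insert
    (by simpa only [hP₀] using hΩD) Finset.univ v hv'
  have hcancel :
      ∑ k, (hM γ (vs k) v * (a (vs k) * ∏ j ∈ Finset.univ.erase k, gF γ ε 1 (vs j) (vs k))) •
          B v (P (Finset.univ.erase k)) =
        -∑ k, (hP γ v (vs k) * (d (vs k) *
          ∏ j ∈ Finset.univ.erase k, gF γ ε 2 (vs k) (vs j))) •
            B v (P (Finset.univ.erase k)) := by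
    rw [← Finset.sum_neg_distrib]
    refine Finset.sum_congr rfl fun k _ => ?_
    rw [hBAE k, hM_swap, neg_mul, neg_smul]
  rw [hΦP, LinearMap.add_apply, hA, hD, hcancel, add_smul]
  abel

end
end

section
/- Define, for γ ∈ ℂ with sin γ ≠ 0, the kernels K₀(v;γ) = (1/(2πi)) · sinh(2iγ)/(sinh(v+iγ) sinh(v−iγ)), K₁(v;γ) = (1/(2πi)) · sinh(iγ)/(sinh(v+iγ) sinh v), K₂(v;γ) = (1/(2πi)) · sinh(iγ)/(sinh(v−iγ) sinh v). Then for every c > 0: (a) for every k ∈ ℝ, lim_{ε→0⁺} (ε/c) · K₀(εk/c; π−ε) = −(1/2π) · 2c/(k² + c²); (b) for every k ∈ ℝ with k ≠ 0, lim_{ε→0⁺} (ε/c) · K₁(εk/c − i(π−ε); π−ε) = −(1/2π) · c/(k(k + ic)); (c) for every k ∈ ℝ with k ≠ 0, lim_{ε→0⁺} (ε/c) · K₂(εk/c + i(π−ε); π−ε) = −(1/2π) · c/(k(k − ic)). -/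
open Complex

noncomputable section

/-- Kernel `K₀(v;γ)` of the nonlinear integral equations for the Perk-Schultz QTM. -/
def K0ker (v γ : ℂ) : ℂ :=
  (1 / (2 * (Real.pi : ℂ) * Complex.I)) *
    (Complex.sinh (2 * Complex.I * γ) /
      (Complex.sinh (v + Complex.I * γ) * Complex.sinh (v - Complex.I * γ)))

/-- Kernel `K₁(v;γ)`. -/
def K1ker (v γ : ℂ) : ℂ :=
  (1 / (2 * (Real.pi : ℂ) * Complex.I)) *
    (Complex.sinh (Complex.I * γ) /
      (Complex.sinh (v + Complex.I * γ) * Complex.sinh v))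

/-- Kernel `K₂(v;γ)`. -/
def K2ker (v γ : ℂ) : ℂ :=
  (1 / (2 * (Real.pi : ℂ) * Complex.I)) *
    (Complex.sinh (Complex.I * γ) /
      (Complex.sinh (v - Complex.I * γ) * Complex.sinh v))

/-- As `ε → 0⁺`, the function `sinh` may be replaced by its linearization in such a ratio. -/
theorem tendsto_mul_sinh_div_sinh_mul_sinh {a b d : ℂ} (hb : b ≠ 0) (hd : d ≠ 0) :
    Filter.Tendsto
      (fun ε : ℝ => (ε : ℂ) * (Complex.sinh (ε * a) / (Complex.sinh (ε * b) * Complex.sinh (ε * d))))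
      (nhdsWithin 0 (Set.Ioi 0)) (nhds (a / (b * d))) := by
  have slope (a : ℂ) : Filter.Tendsto (fun ε : ℝ => Complex.sinh (ε * a) / ε)
      (nhdsWithin 0 (Set.Ioi 0)) (nhds a) := by
    have h : HasDerivAt (fun ε : ℝ => Complex.sinh (ε * a)) a 0 := by
      simpa using ((hasDerivAt_id ((0 : ℝ) : ℂ)).mul_const a).csinh.comp_ofReal
    have h' := h.tendsto_slope_zero_right
    simp only [zero_add, Complex.ofReal_zero, zero_mul, Complex.sinh_zero, sub_zero] at h'
    refine h'.congr fun ε => ?_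
    rw [Complex.real_smul, Complex.ofReal_inv, div_eq_inv_mul]
  refine ((slope a).div ((slope b).mul (slope d)) (mul_ne_zero hb hd)).congr' ?_
  filter_upwards [self_mem_nhdsWithin] with ε hε
  have hε' : (ε : ℂ) ≠ 0 := Complex.ofReal_ne_zero.mpr (ne_of_gt hε)
  simp only [Pi.div_apply]
  rw [div_mul_div_comm, div_div_div_eq, mul_comm (Complex.sinh _) ((ε : ℂ) * ε), mul_assoc,
    mul_div_mul_left _ _ hε', mul_div_assoc]

theorem ofReal_add_I_mul_ofReal_ne_zero {x y : ℝ} (h : y ≠ 0) : (x : ℂ) + I * y ≠ 0 := by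
  intro H
  exact h (by simpa using congrArg Complex.im H)

theorem ofReal_sub_I_mul_ofReal_ne_zero {x y : ℝ} (h : y ≠ 0) : (x : ℂ) - I * y ≠ 0 := by
  intro H
  exact h (by simpa using congrArg Complex.im H)

/-- Continuum limit of the lattice integration kernels: with anisotropy `γ = π − ε` and
rescaled rapidity `v = εk/c`, the rescaled kernels converge to the kernels
`K₀^B, K₁^B, K₂^B` of the two-component Bose gas (up to the stated sign). -/
theorem stmt15 (c : ℝ) (hc : 0 < c) :
    (∀ k : ℝ,
      Filter.Tendsto
        (fun ε : ℝ => ((ε / c : ℝ) : ℂ) * K0ker ((ε * k / c : ℝ) : ℂ) ((Real.pi - ε : ℝ) : ℂ))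
        (nhdsWithin 0 (Set.Ioi 0))
        (nhds (-((1 / (2 * (Real.pi : ℂ))) * (2 * (c : ℂ) / ((k : ℂ) ^ 2 + (c : ℂ) ^ 2)))))) ∧
    (∀ k : ℝ, k ≠ 0 →
      Filter.Tendsto
        (fun ε : ℝ => ((ε / c : ℝ) : ℂ) *
          K1ker (((ε * k / c : ℝ) : ℂ) - Complex.I * ((Real.pi - ε : ℝ) : ℂ))
            ((Real.pi - ε : ℝ) : ℂ))
        (nhdsWithin 0 (Set.Ioi 0))
        (nhds (-((1 / (2 * (Real.pi : ℂ))) *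
          ((c : ℂ) / ((k : ℂ) * ((k : ℂ) + Complex.I * (c : ℂ)))))))) ∧
    (∀ k : ℝ, k ≠ 0 →
      Filter.Tendsto
        (fun ε : ℝ => ((ε / c : ℝ) : ℂ) *
          K2ker (((ε * k / c : ℝ) : ℂ) + Complex.I * ((Real.pi - ε : ℝ) : ℂ))
            ((Real.pi - ε : ℝ) : ℂ))
        (nhdsWithin 0 (Set.Ioi 0))
        (nhds (-((1 / (2 * (Real.pi : ℂ))) *
          ((c : ℂ) / ((k : ℂ) * ((k : ℂ) - Complex.I * (c : ℂ)))))))) := by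
  have hc0 : (c : ℂ) ≠ 0 := Complex.ofReal_ne_zero.mpr hc.ne'
  have hplus (k : ℝ) : (k : ℂ) + I * c ≠ 0 := ofReal_add_I_mul_ofReal_ne_zero hc.ne'
  have hminus (k : ℝ) : (k : ℂ) - I * c ≠ 0 := ofReal_sub_I_mul_ofReal_ne_zero hc.ne'
  have sinh_iγ (ε : ℝ) : Complex.sinh (I * ((Real.pi - ε : ℝ) : ℂ)) = Complex.sinh (ε * I) := by
    rw [show I * ((Real.pi - ε : ℝ) : ℂ) = -(ε * I) + Real.pi * I by push_cast; ring,
      sinh_add_pi_mul_I, Complex.sinh_neg, neg_neg]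
  have sinh_add_iγ (k ε : ℝ) :
      Complex.sinh (((ε * k / c : ℝ) : ℂ) + I * ((Real.pi - ε : ℝ) : ℂ)) =
        -Complex.sinh (ε * ((k - I * c) / c)) := by
    rw [← sinh_add_pi_mul_I]
    congr 1
    push_cast
    field_simp
    ring
  have sinh_sub_iγ (k ε : ℝ) :
      Complex.sinh (((ε * k / c : ℝ) : ℂ) - I * ((Real.pi - ε : ℝ) : ℂ)) =
        -Complex.sinh (ε * ((k + I * c) / c)) := by
    rw [← sinh_sub_pi_mul_I]
    congr 1
    push_cast
    field_simp
    ring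
  have sinh_real (k ε : ℝ) :
      Complex.sinh ((ε * k / c : ℝ) : ℂ) = Complex.sinh (ε * ((k : ℂ) / c)) := by
    push_cast
    rw [mul_div_assoc]
  refine ⟨fun k => ?_, fun k hk => ?_, fun k hk => ?_⟩
  · convert (tendsto_mul_sinh_div_sinh_mul_sinh (a := -(2 * I)) (div_ne_zero (hminus k) hc0)
      (div_ne_zero (hplus k) hc0)).const_mul (1 / (c * (2 * (Real.pi : ℂ) * I))) using 1
    · funext ε
      have h2 : Complex.sinh (2 * I * ((Real.pi - ε : ℝ) : ℂ)) = Complex.sinh (ε * -(2 * I)) := by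
        rw [show 2 * I * ((Real.pi - ε : ℝ) : ℂ) =
            ε * -(2 * I) + Real.pi * I + Real.pi * I by push_cast; ring,
          sinh_add_pi_mul_I, sinh_add_pi_mul_I, neg_neg]
      rw [K0ker, h2, sinh_add_iγ, sinh_sub_iγ, neg_mul_neg, Complex.ofReal_div]
      ring
    · have hfac : (k : ℂ) ^ 2 + (c : ℂ) ^ 2 = (k - I * c) * (k + I * c) := by
        linear_combination (c : ℂ) ^ 2 * I_sq
      have := hplus k
      have := hminus k
      rw [hfac]
      congr 1
      field_simp
  · have hk0 : (k : ℂ) ≠ 0 := Complex.ofReal_ne_zero.mpr hk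
    convert (tendsto_mul_sinh_div_sinh_mul_sinh (a := I) (div_ne_zero hk0 hc0)
      (div_ne_zero (hplus k) hc0)).const_mul (-(1 / (c * (2 * (Real.pi : ℂ) * I)))) using 1
    · funext ε
      rw [K1ker, sub_add_cancel, sinh_iγ, sinh_sub_iγ, sinh_real, mul_neg, div_neg,
        Complex.ofReal_div]
      ring
    · have := hplus k
      congr 1
      field_simp
  · have hk0 : (k : ℂ) ≠ 0 := Complex.ofReal_ne_zero.mpr hk
    convert (tendsto_mul_sinh_div_sinh_mul_sinh (a := I) (div_ne_zero hk0 hc0)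
      (div_ne_zero (hminus k) hc0)).const_mul (-(1 / (c * (2 * (Real.pi : ℂ) * I)))) using 1
    · funext ε
      rw [K2ker, add_sub_cancel_right, sinh_iγ, sinh_add_iγ, sinh_real, mul_neg, div_neg,
        Complex.ofReal_div]
      ring
    · have := hminus k
      congr 1
      field_simp

end
end

section
/- For every c > 0 and every k ∈ ℝ, the following identity holds: ∫_ℝ [ 3c / (2π((3c/2)² + (k−k')²)) ] · [ 1 / (2c·cosh(πk'/c)) ] dk' + (1/2π) ∫_ℝ e^{ikx} · e^{−c|x|/2} / (2·cosh(cx/2)) dx = (1/2π) · 2c/(k² + c²). In other words, (a₃ ∗ f)(k) + K̃₀(k) = K₀^B(k), where a₃(k) = 3c/(2π((3c/2)²+k²)), f(k) = 1/(2c·cosh(πk/c)), K̃₀(k) = (1/2π)∫_ℝ e^{ikx} e^{−c|x|/2}/(2 cosh(cx/2)) dx, and K₀^B(k) = (1/2π)·2c/(k²+c²). Both integrals converge absolutely. -/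
open MeasureTheory

open Set in
theorem integral_cexp_mul_exp_neg_mul_abs {a : ℝ} (ha : 0 < a) (k : ℝ) :
    Integrable (fun x : ℝ => Complex.exp (Complex.I * k * x) * (Real.exp (-(a * |x|)) : ℝ)) ∧
    ∫ x : ℝ, Complex.exp (Complex.I * k * x) * (Real.exp (-(a * |x|)) : ℝ) =
      2 * (a : ℂ) / ((k : ℂ) ^ 2 + (a : ℂ) ^ 2) := by
  have hpos : EqOn (fun x : ℝ => Complex.exp ((Complex.I * k - a) * x))
      (fun x : ℝ => Complex.exp (Complex.I * k * x) * (Real.exp (-(a * |x|)) : ℝ)) (Ioi 0) := by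
    intro x hx
    simp only [abs_of_pos (mem_Ioi.1 hx)]
    push_cast
    rw [← Complex.exp_add]
    ring_nf
  have hneg : EqOn (fun x : ℝ => Complex.exp ((Complex.I * k + a) * x))
      (fun x : ℝ => Complex.exp (Complex.I * k * x) * (Real.exp (-(a * |x|)) : ℝ)) (Iic 0) := by
    intro x hx
    simp only [abs_of_nonpos (mem_Iic.1 hx)]
    push_cast
    rw [← Complex.exp_add]
    ring_nf
  have hre₁ : (Complex.I * k - a).re < 0 := by simpa using ha
  have hre₂ : 0 < (Complex.I * k + a).re := by simpa using ha
  have h₁ := (integrableOn_exp_mul_complex_Ioi hre₁ 0).congr_fun hpos measurableSet_Ioi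
  have h₂ := (integrableOn_exp_mul_complex_Iic hre₂ 0).congr_fun hneg measurableSet_Iic
  refine ⟨by simpa using h₂.union h₁, ?_⟩
  rw [← intervalIntegral.integral_Iic_add_Ioi h₂ h₁, ← setIntegral_congr_fun measurableSet_Ioi hpos,
    ← setIntegral_congr_fun measurableSet_Iic hneg, integral_exp_mul_complex_Ioi hre₁,
    integral_exp_mul_complex_Iic hre₂]
  have n₁ : Complex.I * k - a ≠ 0 := fun h => by simp [h] at hre₁
  have n₂ : Complex.I * k + a ≠ 0 := fun h => by simp [h] at hre₂
  have e : (k : ℂ) ^ 2 + (a : ℂ) ^ 2 = -((Complex.I * k - a) * (Complex.I * k + a)) := by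
    linear_combination (k : ℂ) ^ 2 * Complex.I_sq
  rw [e]
  simp only [Complex.ofReal_zero, mul_zero, Complex.exp_zero]
  field_simp
  ring

theorem integrable_exp_neg_mul_abs {a : ℝ} (ha : 0 < a) :
    Integrable (fun x : ℝ => Real.exp (-(a * |x|))) := by
  have h := (integral_cexp_mul_exp_neg_mul_abs ha 0).1.re
  simpa [Complex.exp_ofReal_re, -Complex.ofReal_exp] using! h

theorem integrable_one_div_cosh_mul {a : ℝ} (ha : 0 < a) :
    Integrable (fun x : ℝ => 1 / Real.cosh (a * x)) := by
  refine ((integrable_exp_neg_mul_abs ha).const_mul 2).mono' ?_ (.of_forall fun x => ?_)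
  · exact (Continuous.div (by fun_prop) (by fun_prop)
      fun x => (Real.cosh_pos _).ne').aestronglyMeasurable
  · rw [Real.norm_of_nonneg (by positivity [Real.cosh_pos (a * x)]), div_le_iff₀ (Real.cosh_pos _),
      ← Real.cosh_abs, abs_mul, abs_of_pos ha, Real.cosh_eq]
    have := Real.exp_pos (-(a * |x|))
    have h : Real.exp (-(a * |x|)) * Real.exp (a * |x|) = 1 := by rw [← Real.exp_add]; simp
    nlinarith

open Set in
theorem betaIntegral_eq_integral_sigmoid (u v : ℂ) :
    Complex.betaIntegral u v =
      ∫ y : ℝ, (Real.sigmoid y : ℂ) ^ u * (Real.sigmoid (-y) : ℂ) ^ v := by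
  have h := integral_image_eq_integral_abs_deriv_smul MeasurableSet.univ
    (fun y _ => (Real.hasDerivAt_sigmoid y).hasDerivWithinAt) Real.sigmoid_injective.injOn
    (fun x : ℝ => (x : ℂ) ^ (u - 1) * (1 - (x : ℂ)) ^ (v - 1))
  rw [image_univ, Real.range_sigmoid, setIntegral_univ] at h
  rw [Complex.betaIntegral, intervalIntegral.integral_of_le zero_le_one,
    integral_Ioc_eq_integral_Ioo, h]
  refine integral_congr_ae (.of_forall fun y => ?_)
  have p := Real.sigmoid_pos y
  have q := Real.sigmoid_pos (-y)
  have hq : (1 : ℂ) - (Real.sigmoid y : ℂ) = (Real.sigmoid (-y) : ℂ) := by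
    rw [Real.sigmoid_neg]; push_cast; ring
  have p' : (Real.sigmoid y : ℂ) ≠ 0 := by exact_mod_cast p.ne'
  have q' : (Real.sigmoid (-y) : ℂ) ≠ 0 := by exact_mod_cast q.ne'
  simp only [hq]
  rw [← Real.sigmoid_neg, abs_of_pos (mul_pos p q), Complex.cpow_sub _ _ p',
    Complex.cpow_sub _ _ q', Complex.real_smul]
  push_cast
  simp only [Complex.cpow_one]
  field_simp

theorem integral_cexp_div_cosh_half (s : ℝ) :
    ∫ y : ℝ, Complex.exp (Complex.I * s * y) * ((1 / (2 * Real.cosh (y / 2)) : ℝ) : ℂ) =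
      ((Real.pi / Real.cosh (Real.pi * s) : ℝ) : ℂ) := by
  set u : ℂ := 1 / 2 + Complex.I * s with hu
  have hre : u.re = 1 / 2 := by simp [hu]
  have hre' : (1 - u).re = 1 / 2 := by rw [Complex.sub_re, hre]; norm_num
  have h := Complex.Gamma_mul_Gamma_eq_betaIntegral (s := u) (t := 1 - u)
    (by rw [hre]; norm_num) (by rw [hre']; norm_num)
  rw [add_sub_cancel, Complex.Gamma_one, one_mul, Complex.Gamma_mul_Gamma_one_sub,
    betaIntegral_eq_integral_sigmoid] at h
  have hsin : Complex.sin (Real.pi * u) = Complex.cosh (Real.pi * s) := by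
    rw [← Complex.cos_mul_I, ← Complex.cos_pi_div_two_sub, ← Complex.cos_neg, hu]
    ring_nf
  rw [hsin] at h
  push_cast
  rw [h]
  refine integral_congr_ae (.of_forall fun y => ?_)
  have hy : Real.sigmoid y = Real.exp (y / 2) * (1 / (2 * Real.cosh (y / 2))) := by
    rw [Real.sigmoid_def, Real.cosh_eq, ← one_div]
    have e1 : Real.exp (-y) = Real.exp (-(y / 2)) * Real.exp (-(y / 2)) := by
      rw [← Real.exp_add]; ring_nf
    have e2 : Real.exp (y / 2) * Real.exp (-(y / 2)) = 1 := by
      rw [← Real.exp_add]; simp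
    have := Real.exp_pos (-(y / 2))
    have := Real.exp_pos (y / 2)
    rw [e1]
    field_simp
    linear_combination (-Real.exp (-(y / 2))) * e2
  have hneg : Real.sigmoid (-y) = Real.exp (-y) * Real.sigmoid y := by
    rw [mul_comm, Real.sigmoid_mul_rexp_neg]
  have p := Real.sigmoid_pos y
  have p' : (Real.sigmoid y : ℂ) ≠ 0 := by exact_mod_cast p.ne'
  have hexp : (Real.exp (-y) : ℂ) ^ (1 - u) = Complex.exp (-y * (1 - u)) := by
    rw [Complex.cpow_def_of_ne_zero (by exact_mod_cast (Real.exp_pos _).ne'),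
      ← Complex.ofReal_log (Real.exp_pos _).le, Real.log_exp]
    push_cast; rfl
  simp only
  rw [hneg, Complex.ofReal_mul, Complex.mul_cpow_ofReal_nonneg (Real.exp_pos _).le p.le, hexp,
    mul_left_comm, ← Complex.cpow_add _ _ p', add_sub_cancel, Complex.cpow_one, hy]
  push_cast
  rw [← mul_assoc, ← Complex.exp_add, hu]
  ring_nf

theorem integral_cexp_div_cosh {c : ℝ} (hc : 0 < c) (x : ℝ) :
    ∫ y : ℝ, Complex.exp (-(Complex.I * x * y)) *
        ((1 / (2 * c * Real.cosh (Real.pi * y / c)) : ℝ) : ℂ) =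
      ((1 / (2 * Real.cosh (c * x / 2)) : ℝ) : ℂ) := by
  have hπ := Real.pi_pos
  have h := Measure.integral_comp_mul_left (fun y : ℝ => Complex.exp (Complex.I *
    ((-(c * x / (2 * Real.pi)) : ℝ) : ℂ) * y) * ((1 / (2 * Real.cosh (y / 2)) : ℝ) : ℂ))
    (2 * Real.pi / c)
  rw [integral_cexp_div_cosh_half] at h
  have e : ∀ y : ℝ, Complex.exp (-(Complex.I * x * y)) *
        ((1 / (2 * c * Real.cosh (Real.pi * y / c)) : ℝ) : ℂ) = ((1 / c : ℝ) : ℂ) *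
      (Complex.exp (Complex.I * ((-(c * x / (2 * Real.pi)) : ℝ) : ℂ) *
        ((2 * Real.pi / c * y : ℝ) : ℂ)) *
        ((1 / (2 * Real.cosh (2 * Real.pi / c * y / 2)) : ℝ) : ℂ)) := by
    intro y
    have e1 : 2 * Real.pi / c * y / 2 = Real.pi * y / c := by field_simp
    have e2 : Complex.I * ((-(c * x / (2 * Real.pi)) : ℝ) : ℂ) * ((2 * Real.pi / c * y : ℝ) : ℂ) =
        -(Complex.I * x * y) := by
      rw [mul_assoc, ← Complex.ofReal_mul]
      have : -(c * x / (2 * Real.pi)) * (2 * Real.pi / c * y) = -(x * y) := by field_simp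
      rw [this]; push_cast; ring
    rw [e1, e2, mul_left_comm, ← Complex.ofReal_mul]
    congr 2
    field_simp
  simp_rw [e]
  rw [integral_const_mul, h, Complex.real_smul, ← Complex.ofReal_mul, ← Complex.ofReal_mul,
    abs_of_pos (by positivity)]
  congr 1
  have e3 : Real.pi * -(c * x / (2 * Real.pi)) = -(c * x / 2) := by field_simp
  rw [e3, Real.cosh_neg]
  have := Real.cosh_pos (c * x / 2)
  field_simp

theorem integrable_lorentzian_mul {g : ℝ → ℝ} (hg : Integrable g) {a : ℝ} (ha : 0 < a) (k : ℝ) :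
    Integrable (fun y : ℝ => 2 * a / (2 * Real.pi * (a ^ 2 + (k - y) ^ 2)) * g y) := by
  have hden : ∀ y : ℝ, 0 < 2 * Real.pi * (a ^ 2 + (k - y) ^ 2) := fun y => by positivity
  refine hg.bdd_mul (c := 2 * a / (2 * Real.pi * a ^ 2)) ?_ (.of_forall fun y => ?_)
  · exact (Continuous.div (by fun_prop) (by fun_prop)
      fun y => (hden y).ne').aestronglyMeasurable
  · rw [Real.norm_of_nonneg (by have := hden y; positivity)]
    gcongr
    nlinarith [sq_nonneg (k - y)]

/-- Convolution with the Lorentzian `2a / (2π(a² + k²))`, whose Fourier transform is `e^{-a|x|}`. -/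
theorem integral_lorentzian_mul {g : ℝ → ℝ} (hg : Integrable g) {a : ℝ} (ha : 0 < a) (k : ℝ) :
    ((∫ y : ℝ, 2 * a / (2 * Real.pi * (a ^ 2 + (k - y) ^ 2)) * g y : ℝ) : ℂ) =
      1 / (2 * (Real.pi : ℂ)) * ∫ x : ℝ, Complex.exp (Complex.I * k * x) *
        (Real.exp (-(a * |x|)) : ℝ) * ∫ y : ℝ, Complex.exp (-(Complex.I * x * y)) * (g y : ℂ) := by
  have hF : Integrable (Function.uncurry fun x y : ℝ =>
      Complex.exp (Complex.I * k * x) * (Real.exp (-(a * |x|)) : ℝ) *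
        (Complex.exp (-(Complex.I * x * y)) * (g y : ℂ))) (volume.prod volume) := by
    have h := ((integral_cexp_mul_exp_neg_mul_abs ha k).1.mul_prod hg.ofReal).bdd_mul
      (f := fun p : ℝ × ℝ => Complex.exp (-(Complex.I * p.1 * p.2))) (c := 1)
      (Continuous.aestronglyMeasurable (by fun_prop))
      (.of_forall fun p => by simp [Complex.norm_exp])
    refine h.congr (.of_forall fun p => ?_)
    simp only [Function.uncurry]
    exact mul_left_comm _ _ _
  simp_rw [← integral_const_mul (Complex.exp _ * _)]
  rw [integral_integral_swap hF, ← integral_const_mul, ← integral_complex_ofReal]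
  refine integral_congr_ae (.of_forall fun y => ?_)
  have e : ∀ x : ℝ, Complex.exp (Complex.I * k * x) * (Real.exp (-(a * |x|)) : ℝ) *
      (Complex.exp (-(Complex.I * x * y)) * (g y : ℂ)) =
      Complex.exp (Complex.I * ((k - y : ℝ) : ℂ) * x) * (Real.exp (-(a * |x|)) : ℝ) *
        (g y : ℂ) := by
    intro x
    have : Complex.exp (Complex.I * ((k - y : ℝ) : ℂ) * x) =
        Complex.exp (Complex.I * k * x) * Complex.exp (-(Complex.I * x * y)) := by
      rw [← Complex.exp_add]; push_cast; ring_nf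
    rw [this]; ring
  simp only [e]
  rw [integral_mul_const, (integral_cexp_mul_exp_neg_mul_abs ha (k - y)).2, ← mul_assoc]
  push_cast
  rw [add_comm ((a : ℂ) ^ 2), div_mul_div_comm, one_mul]

/-- Kernel identity `(a₃ ∗ f)(k) + K̃₀(k) = K₀^B(k)` connecting the TBA kernel of the
two-component Bose gas with the quantum-transfer-matrix kernel:
`∫ a₃(k−k') f(k') dk' + (1/2π)∫ e^{ikx} e^{−c|x|/2}/(2 cosh(cx/2)) dx = (1/2π)·2c/(k²+c²)`,
both integrals being absolutely convergent. -/
theorem stmt16 (c : ℝ) (hc : 0 < c) (k : ℝ) :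
    Integrable (fun k' : ℝ =>
      (3 * c / (2 * Real.pi * ((3 * c / 2) ^ 2 + (k - k') ^ 2))) *
        (1 / (2 * c * Real.cosh (Real.pi * k' / c)))) ∧
    Integrable (fun x : ℝ =>
      Complex.exp (Complex.I * (k : ℂ) * (x : ℂ)) *
        ((Real.exp (-(c * |x| / 2)) : ℝ) : ℂ) / (2 * ((Real.cosh (c * x / 2) : ℝ) : ℂ))) ∧
    ((∫ k' : ℝ,
        (3 * c / (2 * Real.pi * ((3 * c / 2) ^ 2 + (k - k') ^ 2))) *
          (1 / (2 * c * Real.cosh (Real.pi * k' / c))) : ℝ) : ℂ) +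
      (1 / (2 * (Real.pi : ℂ))) *
        ∫ x : ℝ,
          Complex.exp (Complex.I * (k : ℂ) * (x : ℂ)) *
            ((Real.exp (-(c * |x| / 2)) : ℝ) : ℂ) / (2 * ((Real.cosh (c * x / 2) : ℝ) : ℂ)) =
      (1 / (2 * (Real.pi : ℂ))) * (2 * (c : ℂ) / ((k : ℂ) ^ 2 + (c : ℂ) ^ 2)) := by
  have hf : Integrable (fun y : ℝ => 1 / (2 * c * Real.cosh (Real.pi * y / c))) := by
    refine ((integrable_one_div_cosh_mul (a := Real.pi / c) (by positivity)).const_mul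
      (1 / (2 * c))).congr (.of_forall fun y => ?_)
    simp only
    rw [one_div_mul_one_div, div_mul_eq_mul_div]
  have ha : 0 < 3 * c / 2 := by positivity
  have h3 : 2 * (3 * c / 2) = 3 * c := by ring
  have hint := integrable_lorentzian_mul hf ha k
  have hconv := integral_lorentzian_mul hf ha k
  simp only [h3, integral_cexp_div_cosh hc] at hint hconv
  have hbound : ∀ x : ℝ, ‖((1 / (2 * Real.cosh (c * x / 2)) : ℝ) : ℂ)‖ ≤ 1 := fun x => by
    have := Real.one_le_cosh (c * x / 2)
    rw [Complex.norm_real, Real.norm_of_nonneg (by positivity), div_le_one (by positivity)]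
    linarith
  have hmeas : AEStronglyMeasurable (fun x : ℝ => ((1 / (2 * Real.cosh (c * x / 2)) : ℝ) : ℂ)) :=
    (Complex.continuous_ofReal.comp (Continuous.div (by fun_prop) (by fun_prop)
      fun x => by have := Real.cosh_pos (c * x / 2); positivity)).aestronglyMeasurable
  have hprod {a : ℝ} (ha : 0 < a) :=
    (integral_cexp_mul_exp_neg_mul_abs ha k).1.mul_bdd hmeas (.of_forall hbound)
  have hK : (fun x : ℝ => Complex.exp (Complex.I * (k : ℂ) * (x : ℂ)) *
        ((Real.exp (-(c * |x| / 2)) : ℝ) : ℂ) / (2 * ((Real.cosh (c * x / 2) : ℝ) : ℂ))) =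
      fun x : ℝ => Complex.exp (Complex.I * k * x) * (Real.exp (-(c / 2 * |x|)) : ℝ) *
        ((1 / (2 * Real.cosh (c * x / 2)) : ℝ) : ℂ) := by
    funext x
    rw [div_mul_eq_mul_div c 2 |x|]
    push_cast
    rw [mul_one_div]
  rw [hK]
  refine ⟨hint, hprod (by positivity), ?_⟩
  rw [hconv, ← mul_add, ← integral_add (hprod ha) (hprod (by positivity)),
    ← (integral_cexp_mul_exp_neg_mul_abs hc k).2]
  congr 1
  refine integral_congr_ae (.of_forall fun x => ?_)
  have key : (Real.exp (-(3 * c / 2 * |x|)) + Real.exp (-(c / 2 * |x|))) *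
      (1 / (2 * Real.cosh (c * x / 2))) = Real.exp (-(c * |x|)) := by
    have hcosh : Real.cosh (c * x / 2) = Real.cosh (c / 2 * |x|) := by
      rw [← Real.cosh_abs, mul_div_right_comm, abs_mul, abs_of_pos (half_pos hc)]
    have hpos := Real.cosh_pos (c / 2 * |x|)
    rw [hcosh, mul_one_div, div_eq_iff (by positivity), Real.cosh_eq, mul_div_cancel₀ _ two_ne_zero,
      mul_add, ← Real.exp_add, ← Real.exp_add, add_comm]
    ring_nf
  simp only
  rw [← key]
  push_cast
  ring
end

section
/- Triangular action of the quantum transfer matrix monodromy on its pseudovacuum: Let N be a positive even integer, u, v ∈ ℂ, and consider ℂ³⊗(ℂ³)^{⊗N} with sites labelled 1,…,N from right to left. Define, for even j, L_j(v,−u) = Σ_{a,b,a₁,b₁} R^{a a₁}_{b b₁}(v,−u) e_{ab} ⊗ e^{(j)}_{a₁b₁}, and for odd j, L̃_j(u,v) = Σ_{a,b,a₁,b₁} R^{b₁ a}_{a₁ b}(u,v) e_{ab} ⊗ e^{(j)}_{a₁b₁}, and set T^{QTM}(v) = L_N(v,−u) L̃_{N−1}(u,v) ⋯ L₂(v,−u)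 L̃₁(u,v), with 3×3 auxiliary-space entries T^{QTM}_{ab}(v). Let Ω = ⊗_{j=N}^{1} ω_j where ω_j = e₁ for j even and ω_j = e₃ for j odd. Then: T^{QTM}_{21}(v)Ω = T^{QTM}_{31}(v)Ω = T^{QTM}_{32}(v)Ω = 0, T^{QTM}_{11}(v)Ω = (α₁(v,−u)·β(u,v))^{N/2} Ω, T^{QTM}_{22}(v)Ω = (β(v,−u)·β(u,v))^{N/2} Ω, and T^{QTM}_{33}(v)Ω = (β(v,−u)·α₃(u,v))^{N/2} Ω. -/
noncomputable section

/-- Matrix element `⟨is| T^{QTM}_{ab}(v) |js⟩` of the quantum-transfer-matrix monodromy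
`T^{QTM}(v) = L_N(v,−u) L̃_{N−1}(u,v) ⋯ L₂(v,−u) L̃₁(u,v)` in the basis of
`(ℂ³)^{⊗N}` labelled by multi-indices; the Lean index `k : Fin N` labels the site `k+1`
(sites counted from the right), so even sites correspond to odd `k` and carry an
`L`-operator, odd sites an `L̃`-operator. -/
def QTMcoeff (γ : ℂ) (ε : Fin 3 → ℤ) (N : ℕ) (v u : ℂ) (a b : Fin 3)
    (is js : Fin N → Fin 3) : ℂ :=
  ((List.ofFn fun k : Fin N =>
      if k.val % 2 = 1 then
        Matrix.of fun α β : Fin 3 => Rmat γ ε v (-u) α (is k) β (js k)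
      else
        Matrix.of fun α β : Fin 3 => Rmat γ ε u v (js k) α (is k) β).reverse.prod) a b

/-- The action of `T^{QTM}_{ab}(v)` on a vector of `(ℂ³)^{⊗N}`, represented as a function
on multi-indices. -/
def QTMop (γ : ℂ) (ε : Fin 3 → ℤ) (N : ℕ) (v u : ℂ) (a b : Fin 3)
    (ψ : (Fin N → Fin 3) → ℂ) : (Fin N → Fin 3) → ℂ :=
  fun is => ∑ js : Fin N → Fin 3, QTMcoeff γ ε N v u a b is js * ψ js

/-- The staggered pseudovacuum `Ω = ⊗_j ω_j` with `ω_j = e₁` on even sites and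
`ω_j = e₃` on odd sites. -/
def QTMvac (N : ℕ) : (Fin N → Fin 3) → ℂ :=
  fun is => if is = (fun k => if k.val % 2 = 1 then (0 : Fin 3) else 2) then 1 else 0

/-- A product of upper triangular matrices is upper triangular, and its diagonal entries are the
products of the diagonal entries of the factors. -/
theorem blockTriangular_list_prod {n R : Type*} [Fintype n] [LinearOrder n] [CommSemiring R]
    (l : List (Matrix n n R)) (hl : ∀ A ∈ l, ∀ i j, j < i → A i j = 0) :
    (∀ i j, j < i → l.prod i j = 0) ∧ ∀ i, l.prod i i = (l.map fun A => A i i).prod := by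
  induction l with
  | nil => exact ⟨fun i j h => by simp [h.ne'], fun i => by simp⟩
  | cons A l ih =>
    obtain ⟨ih₁, ih₂⟩ := ih fun B hB => hl B (List.mem_cons_of_mem _ hB)
    have hA := hl A List.mem_cons_self
    refine ⟨fun i j hij => ?_, fun i => ?_⟩
    · rw [List.prod_cons, Matrix.mul_apply]
      refine Finset.sum_eq_zero fun k _ => ?_
      rcases lt_or_ge k i with hk | hk
      · rw [hA i k hk, zero_mul]
      · rw [ih₁ k j (hij.trans_le hk), mul_zero]
    · rw [List.prod_cons, Matrix.mul_apply, List.map_cons, List.prod_cons, ← ih₂,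
        Finset.sum_eq_single i]
      · intro k _ hk
        rcases lt_or_gt_of_ne hk with hk | hk
        · rw [hA i k hk, zero_mul]
        · rw [ih₁ k i hk, mul_zero]
      · simp

theorem prod_fin_ite_odd {R : Type*} [CommMonoid R] {N : ℕ} (hN : Even N) (c d : R) :
    ∏ k : Fin N, (if k.val % 2 = 1 then c else d) = (c * d) ^ (N / 2) := by
  obtain ⟨m, rfl⟩ := hN.two_dvd
  rw [Fin.prod_univ_eq_prod_range (fun k => if k % 2 = 1 then c else d),
    Nat.mul_div_cancel_left m two_pos]
  induction m with
  | zero => simp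
  | succ m ih =>
    rw [show 2 * (m + 1) = 2 * m + 1 + 1 by ring, Finset.prod_range_succ,
      Finset.prod_range_succ, ih (even_two_mul m),
      if_neg (by omega), if_pos (by omega), pow_succ, mul_assoc, mul_comm d c]

/-- On the first basis vector the `L`-operator is upper triangular in the auxiliary space. -/
theorem Rmat_apply_zero_of_lt (γ : ℂ) (ε : Fin 3 → ℤ) (v w : ℂ) {a b : Fin 3} (h : b < a)
    (i : Fin 3) : Rmat γ ε v w a i b 0 = 0 := by
  have h₁ : a ≠ b := h.ne'
  have h₂ : a ≠ 0 := (Fin.zero_le b).trans_lt h |>.ne'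
  simp [Rmat, h₁, h₂]

theorem Rmat_apply_two_of_lt (γ : ℂ) (ε : Fin 3 → ℤ) (v w : ℂ) {a b : Fin 3} (h : b < a)
    (i : Fin 3) : Rmat γ ε v w 2 a i b = 0 := by
  have h₁ : a ≠ b := h.ne'
  have h₂ : (2 : Fin 3) ≠ b := by omega
  simp [Rmat, h₁, h₂]

theorem Rmat_diag_zero (γ : ℂ) (ε : Fin 3 → ℤ) (v w : ℂ) (a i : Fin 3) :
    Rmat γ ε v w a i a 0 =
      (if a = 0 then alphaF γ ε 0 v w else betaF γ v w) * if i = 0 then 1 else 0 := by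
  fin_cases a <;> fin_cases i <;> simp [Rmat]

theorem Rmat_diag_two (γ : ℂ) (ε : Fin 3 → ℤ) (v w : ℂ) (a i : Fin 3) :
    Rmat γ ε v w 2 a i a =
      (if a = 2 then alphaF γ ε 2 v w else betaF γ v w) * if i = 2 then 1 else 0 := by
  fin_cases a <;> fin_cases i <;> simp [Rmat]

theorem QTMop_vac_apply (γ : ℂ) (ε : Fin 3 → ℤ) (N : ℕ) (v u : ℂ) (a b : Fin 3)
    (is : Fin N → Fin 3) :
    QTMop γ ε N v u a b (QTMvac N) is =
      QTMcoeff γ ε N v u a b is fun k => if k.val % 2 = 1 then 0 else 2 := by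
  simp [QTMop, QTMvac]

/-- The factors of the monodromy are upper triangular on the pseudovacuum. -/
theorem QTM_factor_upper (γ : ℂ) (ε : Fin 3 → ℤ) (N : ℕ) (v u : ℂ) (is : Fin N → Fin 3) :
    ∀ A ∈ (List.ofFn fun k : Fin N =>
      if k.val % 2 = 1 then
        Matrix.of fun α β : Fin 3 =>
          Rmat γ ε v (-u) α (is k) β (if k.val % 2 = 1 then 0 else 2)
      else
        Matrix.of fun α β : Fin 3 =>
          Rmat γ ε u v (if k.val % 2 = 1 then 0 else 2) α (is k) β).reverse,
      ∀ a b, b < a → A a b = 0 := by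
  intro A hA a b hab
  rw [List.mem_reverse, List.mem_ofFn] at hA
  obtain ⟨k, rfl⟩ := hA
  by_cases hk : k.val % 2 = 1
  · simpa [hk] using Rmat_apply_zero_of_lt γ ε v (-u) hab (is k)
  · simpa [hk] using Rmat_apply_two_of_lt γ ε u v hab (is k)

theorem QTMop_vac_of_lt (γ : ℂ) (ε : Fin 3 → ℤ) (N : ℕ) (v u : ℂ) {a b : Fin 3} (h : b < a) :
    QTMop γ ε N v u a b (QTMvac N) = 0 := by
  funext is
  rw [QTMop_vac_apply]
  exact (blockTriangular_list_prod _ (QTM_factor_upper γ ε N v u is)).1 a b h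

theorem QTMop_vac_diag (γ : ℂ) (ε : Fin 3 → ℤ) {N : ℕ} (hN : Even N) (v u : ℂ) (a : Fin 3) :
    QTMop γ ε N v u a a (QTMvac N) =
      ((if a = 0 then alphaF γ ε 0 v (-u) else betaF γ v (-u)) *
        (if a = 2 then alphaF γ ε 2 u v else betaF γ u v)) ^ (N / 2) • QTMvac N := by
  funext is
  rw [QTMop_vac_apply, QTMcoeff,
    (blockTriangular_list_prod _ (QTM_factor_upper γ ε N v u is)).2 a, List.map_reverse,
    List.prod_reverse, List.map_ofFn, List.prod_ofFn, ← prod_fin_ite_odd hN, Pi.smul_apply,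
    smul_eq_mul, QTMvac]
  have hvac : (if is = (fun k => if k.val % 2 = 1 then (0 : Fin 3) else 2) then (1 : ℂ) else 0) =
      ∏ k, if is k = (if k.val % 2 = 1 then (0 : Fin 3) else 2) then 1 else 0 := by
    rw [Finset.prod_ite_zero]
    simp [funext_iff]
  rw [hvac, ← Finset.prod_mul_distrib]
  refine Finset.prod_congr rfl fun k _ => ?_
  by_cases hk : k.val % 2 = 1
  · simp only [Function.comp_apply, hk, if_true, Matrix.of_apply, Rmat_diag_zero]
  · simp only [Function.comp_apply, hk, if_false, Matrix.of_apply, Rmat_diag_two]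

/-- Triangular action of the quantum transfer matrix monodromy on its pseudovacuum:
the lower-triangular entries annihilate `Ω` and the diagonal entries act by the scalars
`(α₁(v,−u)β(u,v))^{N/2}`, `(β(v,−u)β(u,v))^{N/2}` and `(β(v,−u)α₃(u,v))^{N/2}`. -/
theorem stmt18 (γ : ℂ) (hγ : Complex.sin γ ≠ 0) (ε : Fin 3 → ℤ)
    (hε : ∀ a, ε a = 1 ∨ ε a = -1) (N : ℕ) (hNpos : 0 < N) (hNeven : Even N) (u v : ℂ) :
    QTMop γ ε N v u 1 0 (QTMvac N) = 0 ∧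
    QTMop γ ε N v u 2 0 (QTMvac N) = 0 ∧
    QTMop γ ε N v u 2 1 (QTMvac N) = 0 ∧
    QTMop γ ε N v u 0 0 (QTMvac N) =
      (alphaF γ ε 0 v (-u) * betaF γ u v) ^ (N / 2) • QTMvac N ∧
    QTMop γ ε N v u 1 1 (QTMvac N) =
      (betaF γ v (-u) * betaF γ u v) ^ (N / 2) • QTMvac N ∧
    QTMop γ ε N v u 2 2 (QTMvac N) =
      (betaF γ v (-u) * alphaF γ ε 2 u v) ^ (N / 2) • QTMvac N := by
  refine ⟨QTMop_vac_of_lt γ ε N v u (by decide), QTMop_vac_of_lt γ ε N v u (by decide),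
    QTMop_vac_of_lt γ ε N v u (by decide), ?_, ?_, ?_⟩
  · simpa using QTMop_vac_diag γ ε hNeven v u 0
  · simpa using QTMop_vac_diag γ ε hNeven v u 1
  · simpa using QTMop_vac_diag γ ε hNeven v u 2

end
end
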